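/- Let Y = Y₁ + Y₂ where Y₁ is independent of the pair (Y₂, Z), and suppose Y₁ has an integrable characteristic function ψ_{Y₁} ∈ L¹(ℝ). Let f : ℝ → ℝ be bounded and integrable with Fourier transform f̂(λ) = ∫ f(x)e^{iλx} dx, let g be a measurable function with E|g(Z)| < ∞, and let y₀ ∈ ℝ. Then E[f(y₀ + Y)g(Z)] = (1/2π) ∫_ℝ f̂(λ) e^{-iλ y₀} E[e^{-iλY} g(Z)] dλ. -/

import Mathlib

open MeasureTheory Complex ProbabilityTheory
open scoped FourierTransform SchwartzMap

noncomputable def GG (ν : Measure ℝ) : ℝ → ℂ :=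
  VectorFourier.fourierIntegral Real.fourierChar ν (innerₗ ℝ) (fun _ => (1:ℂ))

lemma GG_eq (ν : Measure ℝ) (x : ℝ) : GG ν x = charFun ν (-(2 * Real.pi) * x) := by
  rw [charFun_eq_fourierIntegral', GG]
  congr 1
  simp only [smul_eq_mul]
  field_simp

lemma GG_int (ν : Measure ℝ) (h : Integrable (charFun ν)) : Integrable (GG ν) := by
  have := h.comp_mul_left' (R := -(2 * Real.pi)) (by simp [Real.pi_ne_zero])
  refine this.congr (Filter.Eventually.of_forall fun x => ?_)
  simp [GG_eq]

lemma flipInv (h k : ℝ → ℂ) (hh : Integrable h) (hk : Integrable k) :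
    ∫ x, (𝓕⁻ h) x * k x = ∫ x, h x * (𝓕⁻ k) x := by
  have := VectorFourier.integral_fourierIntegral_smul_eq_flip (μ := volume) (ν := volume)
    (e := Real.fourierChar) (L := -innerₗ ℝ) Real.continuous_fourierChar
    (by simp only [LinearMap.neg_apply, innerₗ_apply_apply]; fun_prop) hh hk
  have e : (-innerₗ ℝ).flip = -innerₗ ℝ := by
    ext; simp
  rw [e] at this
  exact this

lemma testA (ν : Measure ℝ) [IsProbabilityMeasure ν] (hν : Integrable (charFun ν)) (h : 𝓢(ℝ, ℂ)) :
    ∫ x, h x ∂ν = ∫ x, h x * (𝓕⁻ (GG ν)) x := by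
  have h1 := VectorFourier.integral_fourierIntegral_smul_eq_flip (μ := volume) (ν := ν)
    (e := Real.fourierChar) (L := innerₗ ℝ) (f := (𝓕⁻ h : 𝓢(ℝ, ℂ))) (g := fun _ => (1:ℂ)) Real.continuous_fourierChar
    (by simp only [innerₗ_apply_apply]; fun_prop) (𝓕⁻ h).integrable (by simp)
  rw [flip_innerₗ] at h1
  have h2 : ∀ x, h x = VectorFourier.fourierIntegral Real.fourierChar volume (innerₗ ℝ) (𝓕⁻ h : 𝓢(ℝ, ℂ)) x := by
    intro x
    change h x = 𝓕 ((𝓕⁻ h : 𝓢(ℝ, ℂ)) : ℝ → ℂ) x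
    rw [← SchwartzMap.fourier_coe, FourierTransform.fourier_fourierInv_eq]
  simp only [← h2, smul_eq_mul, mul_one] at h1
  rw [h1, ← flipInv _ _ h.integrable (GG_int ν hν), SchwartzMap.fourierInv_coe]
  rfl

lemma testB (ν : Measure ℝ) [IsProbabilityMeasure ν] (hν : Integrable (charFun ν)) (h : ℝ → ℝ)
    (hs : ContDiff ℝ (⊤ : ℕ∞) h) (hc : HasCompactSupport h) :
    ((∫ x, h x ∂ν : ℝ) : ℂ) = ∫ x, (h x : ℂ) * (𝓕⁻ (GG ν)) x := by
  have hc' : HasCompactSupport (fun x => (h x : ℂ)) := hc.comp_left (g := fun x : ℝ => (x : ℂ)) (by simp)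
  have := testA ν hν (hc'.toSchwartzMap (Complex.ofRealCLM.contDiff.comp hs))
  rw [← integral_complex_ofReal]
  exact this

lemma PP_bound (ν : Measure ℝ) (x : ℝ) : ‖(𝓕⁻ (GG ν)) x‖ ≤ ∫ y, ‖GG ν y‖ :=
  VectorFourier.norm_fourierIntegral_le_integral_norm _ _ _ _ _

lemma PP_cont (ν : Measure ℝ) (hν : Integrable (charFun ν)) : Continuous (𝓕⁻ (GG ν)) :=
  VectorFourier.fourierIntegral_continuous Real.continuous_fourierChar
    (by simp only [LinearMap.neg_apply, innerₗ_apply_apply]; fun_prop) (GG_int ν hν)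

lemma ac (ν : Measure ℝ) [IsProbabilityMeasure ν] (hν : Integrable (charFun ν)) : ν ≪ volume := by
  refine Measure.AbsolutelyContinuous.mk fun s hs h0 => ?_
  rw [hs.measure_eq_iSup_isCompact]
  simp only [ENNReal.iSup_eq_zero]
  intro K hKs hK
  have hK0 : volume K = 0 := measure_mono_null hKs h0
  set C := ∫ y, ‖GG ν y‖ with hC
  have hC0 : 0 ≤ C := integral_nonneg fun _ => norm_nonneg _
  have key : ∀ ε : ℝ, 0 < ε → ν.real K ≤ C * ε := by
    intro ε hε
    obtain ⟨U, hKU, hU, hUε⟩ := K.exists_isOpen_lt_of_lt (μ := volume) (ENNReal.ofReal ε) (by simpa [hK0] using hε)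
    obtain ⟨R, hR⟩ := hK.isBounded.subset_ball 0
    obtain ⟨h, hh0, hh1, hh⟩ := exists_contMDiffMap_zero_one_of_isClosed (n := (⊤ : ℕ∞)) (modelWithCornersSelf ℝ ℝ)
      (s := (U ∩ Metric.ball 0 R)ᶜ) (t := K) (hU.inter Metric.isOpen_ball).isClosed_compl hK.isClosed
      (by rw [Set.disjoint_compl_left_iff_subset]; exact Set.subset_inter hKU hR)
    have hsm : ContDiff ℝ (⊤ : ℕ∞) (h : ℝ → ℝ) := h.contMDiff.contDiff
    have hcs : HasCompactSupport (h : ℝ → ℝ) := by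
      refine HasCompactSupport.intro (isCompact_closedBall (0:ℝ) R) fun x hx => ?_
      exact hh0 fun hx' => hx (Metric.ball_subset_closedBall hx'.2)
    have hi : Integrable h ν := hsm.continuous.integrable_of_hasCompactSupport hcs
    have hi' : Integrable h volume := hsm.continuous.integrable_of_hasCompactSupport hcs
    have e1 : ν.real K ≤ ∫ x, h x ∂ν := by
      rw [← integral_indicator_one hK.measurableSet]
      refine integral_mono ((integrable_const (1:ℝ)).indicator hK.measurableSet) hi fun x => ?_
      by_cases hx : x ∈ K
      · simp [hx, hh1 hx]
      · simpa [hx] using (hh x).1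
    have e2 : ∫ x, h x ∂ν ≤ C * ∫ x, h x := by
      have := congrArg norm (testB ν hν h hsm hcs)
      rw [Complex.norm_real] at this
      refine (le_abs_self _).trans ?_
      rw [← Real.norm_eq_abs, this, ← integral_const_mul]
      refine norm_integral_le_of_norm_le (hi'.const_mul C) (Filter.Eventually.of_forall fun x => ?_)
      rw [norm_mul, Complex.norm_real, Real.norm_eq_abs, abs_of_nonneg (hh x).1, mul_comm]
      exact mul_le_mul_of_nonneg_right (PP_bound ν x) (hh x).1
    have e3 : ∫ x, h x ≤ ε := by
      have : ∫ x, h x ≤ volume.real U := by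
        rw [← integral_indicator_one hU.measurableSet]
        refine integral_mono hi' ((integrable_indicator_iff hU.measurableSet).2 ?_) fun x => ?_
        · exact (integrableOn_const (C := (1:ℝ)) (hs := hUε.ne_top))
        by_cases hx : x ∈ U
        · simpa [hx] using (hh x).2
        · have : h x = 0 := hh0 fun hx' => hx hx'.1
          simp [hx, this]
      exact this.trans (ENNReal.toReal_le_of_le_ofReal hε.le hUε.le)
    exact e1.trans (e2.trans (mul_le_mul_of_nonneg_left e3 hC0))
  have : ν.real K ≤ 0 := by
    by_contra! hpos
    have := key (ν.real K / (2 * (C + 1))) (by positivity)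
    have h2 : C * (ν.real K / (2 * (C + 1))) < ν.real K := by
      rw [mul_div_assoc', div_lt_iff₀ (by positivity)]
      nlinarith
    linarith
  exact (measureReal_eq_zero_iff).1 (le_antisymm this measureReal_nonneg)

lemma dens (ν : Measure ℝ) [IsProbabilityMeasure ν] (hν : Integrable (charFun ν)) :
    ∀ᵐ x, (((ν.rnDeriv volume x).toReal : ℝ) : ℂ) = (𝓕⁻ (GG ν)) x := by
  refine ae_eq_of_integral_contDiff_smul_eq ?_ (PP_cont ν hν).locallyIntegrable fun g hg hgc => ?_
  · exact (Measure.integrable_toReal_rnDeriv (μ := ν) (ν := volume)).ofReal.locallyIntegrable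
  · have := testB ν hν g hg hgc
    simp only [real_smul]
    rw [← this, ← integral_toReal_rnDeriv_mul (ac ν hν), ← integral_complex_ofReal]
    congr with x
    push_cast; ring

lemma coreF (ν : Measure ℝ) [IsProbabilityMeasure ν] (hν : Integrable (charFun ν)) (f : ℝ → ℂ)
    (hf : Integrable f) : ∫ x, f x ∂ν = ∫ x, (𝓕⁻ f) x * GG ν x := by
  rw [flipInv _ _ hf (GG_int ν hν), ← integral_rnDeriv_smul (ac ν hν)]
  refine integral_congr_ae ?_
  filter_upwards [dens ν hν] with x hx
  rw [← hx, real_smul, mul_comm]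

lemma core (ν : Measure ℝ) [IsProbabilityMeasure ν] (hν : Integrable (charFun ν)) (f : ℝ → ℂ)
    (hf : Integrable f) (c : ℝ) : ∫ x, f (c + x) ∂ν = (1 / (2 * Real.pi)) *
        ∫ lam : ℝ, (∫ x : ℝ, f x * Complex.exp (Complex.I * lam * x)) *
          Complex.exp (-Complex.I * lam * c) * charFun ν (-lam) := by
  rw [coreF ν hν (fun x => f (c + x)) (hf.comp_add_left c)]
  have hpi : (Real.pi : ℂ) ≠ 0 := by exact_mod_cast Real.pi_ne_zero
  have := Measure.integral_comp_mul_left (fun lam : ℝ => (∫ x : ℝ, f x * Complex.exp (Complex.I * lam * x)) *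
          Complex.exp (-Complex.I * lam * c) * charFun ν (-lam)) (2 * Real.pi)
  rw [abs_of_nonneg (by positivity), real_smul] at this
  push_cast at this
  rw [one_div, ← this]
  congr with w
  rw [GG_eq, neg_mul]
  congr 1
  rw [Real.fourierInv_eq']
  simp only [smul_eq_mul]
  rw [← integral_add_left_eq_self _ (-c), ← integral_mul_const]
  congr with x
  rw [mul_assoc (f x), ← Complex.exp_add, mul_comm, add_neg_cancel_left]
  congr 2
  simp
  ring

open MeasureTheory Complex ProbabilityTheory

theorem stmt5 {Ω : Type*} [MeasurableSpace Ω] (μ : Measure Ω) [IsProbabilityMeasure μ]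
    (Y₁ Y₂ Z : Ω → ℝ) (hY₁ : Measurable Y₁) (hY₂ : Measurable Y₂) (hZ : Measurable Z)
    (hindep : IndepFun Y₁ (fun ω => (Y₂ ω, Z ω)) μ)
    (hψ : Integrable (fun lam : ℝ => ∫ ω, Complex.exp (Complex.I * lam * Y₁ ω) ∂μ) volume)
    (f : ℝ → ℝ) (hfm : Measurable f) (Cf : ℝ) (hfb : ∀ x, |f x| ≤ Cf)
    (hfi : Integrable f volume)
    (g : ℝ → ℝ) (hgm : Measurable g) (hgi : Integrable (fun ω => g (Z ω)) μ)
    (y₀ : ℝ) :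
    ((∫ ω, f (y₀ + (Y₁ ω + Y₂ ω)) * g (Z ω) ∂μ : ℝ) : ℂ) =
      (1 / (2 * Real.pi)) *
        ∫ lam : ℝ, (∫ x : ℝ, (f x : ℂ) * Complex.exp (Complex.I * lam * x)) *
          Complex.exp (-Complex.I * lam * y₀) *
          ∫ ω, Complex.exp (-Complex.I * lam * (Y₁ ω + Y₂ ω)) * (g (Z ω) : ℂ) ∂μ := by

  set ν := μ.map Y₁ with hνdef
  have : IsProbabilityMeasure ν := Measure.isProbabilityMeasure_map hY₁.aemeasurable
  have hcf : ∀ lam : ℝ, charFun ν lam = ∫ ω, Complex.exp (Complex.I * lam * Y₁ ω) ∂μ := by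
    intro lam
    rw [charFun_apply_real, hνdef, integral_map hY₁.aemeasurable (by fun_prop)]
    congr with ω
    congr 1
    ring
  have hν : Integrable (charFun ν) := by
    rw [show charFun ν = _ from funext hcf]
    exact hψ
  have hW : Measurable (fun ω => (Y₂ ω, Z ω)) := hY₂.prodMk hZ
  set A : ℝ → ℂ := fun lam => ∫ x : ℝ, (f x : ℂ) * Complex.exp (Complex.I * lam * x) with hA
  have hAb : ∀ lam, ‖A lam‖ ≤ ∫ x, ‖f x‖ := by
    intro lam
    refine norm_integral_le_of_norm_le hfi.norm (Filter.Eventually.of_forall fun x => ?_)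
    rw [norm_mul, Complex.norm_real, Complex.norm_exp]
    simp
  have hAm : StronglyMeasurable A := by
    have : Measurable (fun p : ℝ × ℝ => (f p.2 : ℂ) * Complex.exp (Complex.I * p.1 * p.2)) := by
      fun_prop
    exact this.stronglyMeasurable.integral_prod_right
  have hprod := (indepFun_iff_map_prod_eq_prod_map_map hY₁.aemeasurable hW.aemeasurable).1 hindep
  -- left side
  have hL : ((∫ ω, f (y₀ + (Y₁ ω + Y₂ ω)) * g (Z ω) ∂μ : ℝ) : ℂ)
      = ∫ ω, (∫ x, (f ((y₀ + Y₂ ω) + x) : ℂ) ∂ν) * (g (Z ω) : ℂ) ∂μ := by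
    have hFm : Measurable (fun p : ℝ × (ℝ × ℝ) => (f ((y₀ + p.2.1) + p.1) : ℂ) * (g p.2.2 : ℂ)) := by
      fun_prop
    have hFi : Integrable (fun p : ℝ × (ℝ × ℝ) => (f ((y₀ + p.2.1) + p.1) : ℂ) * (g p.2.2 : ℂ))
        ((μ.map Y₁).prod (μ.map (fun ω => (Y₂ ω, Z ω)))) := by
      rw [← hprod, integrable_map_measure hFm.aestronglyMeasurable (hY₁.prodMk hW).aemeasurable]
      refine Integrable.bdd_mul (c := Cf) hgi.ofReal ?_ ?_
      · exact Measurable.aestronglyMeasurable (by fun_prop)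
      · exact Filter.Eventually.of_forall fun ω => by
          simpa [Complex.norm_real] using hfb _
    have e1 := integral_prod_symm _ hFi
    rw [← hprod, integral_map (hY₁.prodMk hW).aemeasurable hFm.aestronglyMeasurable,
      integral_map hW.aemeasurable] at e1
    · rw [← integral_complex_ofReal]
      simp only [integral_mul_const] at e1
      rw [← e1]
      congr with ω
      push_cast
      congr 3
      ring
    · have : Measurable (fun p : (ℝ × ℝ) × ℝ => (f ((y₀ + p.1.1) + p.2) : ℂ) * (g p.1.2 : ℂ)) := by
        fun_prop
      exact this.stronglyMeasurable.integral_prod_right.aestronglyMeasurable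
  have hR : ∀ lam : ℝ, ∫ ω, Complex.exp (-Complex.I * lam * (Y₁ ω + Y₂ ω)) * (g (Z ω) : ℂ) ∂μ
      = charFun ν (-lam) * ∫ ω, Complex.exp (-Complex.I * lam * Y₂ ω) * (g (Z ω) : ℂ) ∂μ := by
    intro lam
    have := hindep.integral_fun_comp_mul_comp (f := fun y : ℝ => Complex.exp (-Complex.I * lam * y))
      (g := fun p : ℝ × ℝ => Complex.exp (-Complex.I * lam * p.1) * (g p.2 : ℂ))
      hY₁.aemeasurable hW.aemeasurable (Measurable.aestronglyMeasurable (by fun_prop))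
      (Measurable.aestronglyMeasurable (by fun_prop))
    rw [hcf]
    push_cast
    simp only [mul_neg, neg_mul] at this ⊢
    rw [← this]
    congr with ω
    rw [← mul_assoc, ← Complex.exp_add]
    congr 2
    ring
  have hcm : StronglyMeasurable (fun lam => charFun ν (-lam)) :=
    (measurable_charFun.comp measurable_neg).stronglyMeasurable
  have hci : Integrable (fun lam => charFun ν (-lam)) := hν.comp_neg
  rw [hL]
  have hcore : ∀ c : ℝ, ∫ x, (f (c + x) : ℂ) ∂ν = (1 / (2 * Real.pi)) *
      ∫ lam : ℝ, A lam * Complex.exp (-Complex.I * lam * c) * charFun ν (-lam) :=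
    core ν hν (fun x => (f x : ℂ)) hfi.ofReal
  have hA' : ∀ lam : ℝ, (∫ x : ℝ, (f x : ℂ) * Complex.exp (Complex.I * lam * x)) = A lam :=
    fun _ => rfl
  clear_value A
  simp only [hcore, hR, hA']
  simp only [mul_assoc]
  rw [integral_const_mul]
  congr 1
  simp only [← integral_mul_const, ← integral_const_mul]
  rw [integral_integral_swap]
  · congr with lam
    congr with ω
    have : Complex.exp (-Complex.I * (lam * ((y₀ + Y₂ ω : ℝ) : ℂ)))
        = Complex.exp (-Complex.I * (lam * y₀)) * Complex.exp (-Complex.I * (lam * Y₂ ω)) := by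
      rw [← Complex.exp_add]
      congr 1
      push_cast
      ring
    rw [this]
    ring
  · have hb : Integrable (fun p : Ω × ℝ => (g (Z p.1) : ℂ) * charFun ν (-p.2)) (μ.prod volume) :=
      hgi.ofReal.mul_prod hci
    have := hb.bdd_mul (c := ∫ x, ‖f x‖)
      (f := fun p : Ω × ℝ => A p.2 * Complex.exp (-Complex.I * (p.2 * ((y₀ + Y₂ p.1 : ℝ) : ℂ))))
      (((hAm.measurable.comp measurable_snd).mul (by fun_prop)).aestronglyMeasurable)
      (Filter.Eventually.of_forall fun p => by
        rw [norm_mul, Complex.norm_exp]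
        simpa using hAb p.2)
    refine this.congr (Filter.Eventually.of_forall fun p => ?_)
    simp only [Function.uncurry]
    ring
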